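/- Let α be a finite set and let x, y be fixed-point-free involutions of α. Then every cycle length of the product x·y occurs an even number of times: for every positive integer ℓ, the multiplicity of ℓ in the full cycle type of x·y is even. -/

import Mathlib

/-- The full cycle type of a permutation of a finite set: the multiset of the lengths of its
cycles, where each fixed point counts as a cycle of length 1. -/
def fullCycleType {α : Type*} [Fintype α] [DecidableEq α] (σ : Equiv.Perm α) : Multiset ℕ :=
  σ.cycleType + Multiset.replicate (Fintype.card α - σ.cycleType.sum) 1

/-- The subgroup generated by a set of permutations acts transitively. -/
def IsTransitiveSet {α : Type*} (s : Set (Equiv.Perm α)) : Prop :=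
  ∀ x y : α, ∃ g ∈ Subgroup.closure s, g x = y

/-- A ramification data, given as a list of multisets of positive integers (partitions of `n`),
is realizable if there are permutations of `{1,…,n}` with product 1, generating a transitive
subgroup, whose full cycle types are the given multisets. -/
def Realizable (n : ℕ) (E : List (Multiset ℕ)) : Prop :=
  ∃ σ : List (Equiv.Perm (Fin n)),
    σ.map fullCycleType = E ∧ σ.prod = 1 ∧ IsTransitiveSet {g | g ∈ σ}

/-- A fixed-point-free involution: a permutation of order 2 without fixed points. -/
def IsFpfInvolution {α : Type*} (σ : Equiv.Perm α) : Prop :=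
  orderOf σ = 2 ∧ ∀ a, σ a ≠ a

section

open Equiv Equiv.Perm

theorem Finset.even_card_of_involutive {ι : Type*} [DecidableEq ι] {s : Finset ι} (g : ι → ι)
    (hg : Function.Involutive g) (hmem : ∀ a ∈ s, g a ∈ s) (hne : ∀ a ∈ s, g a ≠ a) :
    Even s.card := by
  have h : ∑ _a ∈ s, (1 : ZMod 2) = 0 :=
    Finset.sum_involution (fun a _ => g a) (fun _ _ => by decide) (fun a ha _ => hne a ha)
      (fun a ha => hmem a ha) (fun a _ => hg a)
  rw [← ZMod.natCast_eq_zero_iff_even]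
  simpa using h

variable {α : Type*}

theorem IsFpfInvolution.mul_self {σ : Perm α} (hσ : IsFpfInvolution σ) : σ * σ = 1 := by
  rw [← sq, ← hσ.1, pow_orderOf_eq_one]

theorem IsFpfInvolution.inv_eq {σ : Perm α} (hσ : IsFpfInvolution σ) : σ⁻¹ = σ :=
  inv_eq_of_mul_eq_one_left hσ.mul_self

theorem IsFpfInvolution.semiconjBy_mul {x y : Perm α} (hx : IsFpfInvolution x)
    (hy : IsFpfInvolution y) : SemiconjBy x (x * y)⁻¹ (x * y) := by
  simp [SemiconjBy, hx.inv_eq, hy.inv_eq, mul_assoc]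

theorem IsFpfInvolution.mul_apply_zpow {x y : Perm α} (hx : IsFpfInvolution x)
    (hy : IsFpfInvolution y) (m : ℤ) (a : α) :
    x (((x * y) ^ m) a) = ((x * y) ^ (-m)) (x a) := by
  have h := ((hx.semiconjBy_mul hy).zpow_right (-m)).eq
  rw [inv_zpow', neg_neg] at h
  exact DFunLike.congr_fun h a

theorem IsFpfInvolution.not_sameCycle_mul {x y : Perm α} (hx : IsFpfInvolution x)
    (hy : IsFpfInvolution y) (a : α) : ¬ SameCycle (x * y) a (x a) := by
  rintro ⟨k, hk⟩
  obtain ⟨m, rfl | rfl⟩ := Int.even_or_odd' k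
  · apply hx.2 (((x * y) ^ m) a)
    rw [hx.mul_apply_zpow hy, ← hk, ← Perm.mul_apply, ← zpow_add]
    congr 2
    ring
  · apply hy.2 (((x * y) ^ m) a)
    apply x.injective
    rw [hx.mul_apply_zpow hy, ← hk, ← Perm.mul_apply, ← Perm.mul_apply, ← Perm.mul_apply,
      ← zpow_one_add, ← zpow_add]
    congr 2
    ring

variable [Fintype α] [DecidableEq α]

theorem Equiv.Perm.inv_mem_cycleFactorsFinset_inv {σ c : Perm α} (hc : c ∈ σ.cycleFactorsFinset) :
    c⁻¹ ∈ σ⁻¹.cycleFactorsFinset := by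
  rw [mem_cycleFactorsFinset_iff] at hc ⊢
  refine ⟨hc.1.inv, fun a ha => ?_⟩
  have h : c⁻¹ a ∈ c.support := by
    rw [support_inv] at ha
    rw [← apply_mem_support]
    simpa using ha
  rw [eq_inv_iff_eq, ← hc.2 _ h]
  simp

theorem IsFpfInvolution.even_count_cycleType_mul {x y : Perm α} (hx : IsFpfInvolution x)
    (hy : IsFpfInvolution y) (n : ℕ) : Even ((x * y).cycleType.count n) := by
  rw [cycleType_def, Multiset.count_map, ← Finset.filter_val, Finset.card_val]
  refine Finset.even_card_of_involutive (fun c => x * c⁻¹ * x⁻¹) (fun c => ?_) (fun c hc => ?_)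
    (fun c hc heq => ?_)
  · simp only [mul_inv_rev, inv_inv, ← mul_assoc, hx.mul_self, one_mul]
    simp [hx.inv_eq, mul_assoc, hx.mul_self]
  · rw [Finset.mem_filter] at hc ⊢
    refine ⟨?_, ?_⟩
    · have h := (mem_cycleFactorsFinset_conj _ x _).2 (inv_mem_cycleFactorsFinset_inv hc.1)
      rwa [(hx.semiconjBy_mul hy).eq, mul_inv_cancel_right] at h
    · simpa using hc.2
  · have hc' := (Finset.mem_filter.1 hc).1
    obtain ⟨a, ha⟩ := (mem_cycleFactorsFinset_iff.1 hc').1.nonempty_support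
    have hxa : x a ∈ c.support := by
      rw [← heq, support_conj, support_inv]
      exact Finset.mem_map_of_mem x.toEmbedding ha
    exact hx.not_sameCycle_mul hy a ((isCycleOn_support_of_mem_cycleFactorsFinset hc').2 ha hxa)

theorem IsFpfInvolution.even_card_sub_sum_cycleType_mul {x y : Perm α} (hx : IsFpfInvolution x)
    (hy : IsFpfInvolution y) : Even (Fintype.card α - (x * y).cycleType.sum) := by
  rw [sum_cycleType, ← Finset.card_compl]
  refine Finset.even_card_of_involutive x (fun a => ?_) (fun a ha => ?_) (fun a _ => hx.2 a)
  · exact DFunLike.congr_fun hx.mul_self a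
  · rw [Finset.mem_compl, notMem_support] at ha ⊢
    have h := hx.mul_apply_zpow hy (-1) a
    rw [neg_neg, zpow_one, zpow_neg_one, inv_eq_iff_eq.2 ha.symm] at h
    exact h.symm

end

/-- If x, y are fixed-point-free involutions of a finite set, then every cycle length of x·y
occurs an even number of times in the full cycle type of x·y. -/
theorem stmt5 {α : Type*} [Fintype α] [DecidableEq α]
    (x y : Equiv.Perm α)
    (hx : IsFpfInvolution x) (hy : IsFpfInvolution y)
    (ℓ : ℕ) (hℓ : 0 < ℓ) :
    Even ((fullCycleType (x * y)).count ℓ) := by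
  rw [fullCycleType, Multiset.count_add, Multiset.count_replicate]
  refine (hx.even_count_cycleType_mul hy ℓ).add ?_
  split_ifs
  · exact hx.even_card_sub_sum_cycleType_mul hy
  · exact Even.zero
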